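/- Let I be a square-free monomial ideal of R = K[x_1,…,x_r]. Then reg(I^{(n)}) ≥ d(I)·n for all n ≥ 1, where d(I) is the maximal degree of a minimal monomial generator of I. -/

import Mathlib

open MvPolynomial Finset Filter

noncomputable section

/-- A family of potential faces (subsets of the vertex set `ι`). -/
abbrev FaceSet (ι : Type*) := Set (Finset ι)

/-- A face set is a simplicial complex if it is closed under taking subsets. -/
def IsSimplicialComplex {ι : Type*} (Δ : FaceSet ι) : Prop :=
  ∀ σ ∈ Δ, ∀ τ : Finset ι, τ ⊆ σ → τ ∈ Δ

/-- The facets (maximal faces) of a face set. -/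
def facets {ι : Type*} (Δ : FaceSet ι) : FaceSet ι :=
  {σ | σ ∈ Δ ∧ ∀ τ ∈ Δ, σ ⊆ τ → σ = τ}

/-- The Stanley–Reisner ideal of a simplicial complex: it is generated by the
square-free monomials corresponding to non-faces. -/
def srIdeal (K : Type*) [Field K] {ι : Type*} (Δ : FaceSet ι) :
    Ideal (MvPolynomial ι K) :=
  Ideal.span {p | ∃ τ : Finset ι, τ ∉ Δ ∧ p = ∏ i ∈ τ, X i}

/-- The `n`-th symbolic power `I^{(n)} = ⋂_{p ∈ Min(I)} (Iⁿ R_p ∩ R)`. -/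
def symbolicPower {R : Type*} [CommRing R] (I : Ideal R) (n : ℕ) : Ideal R :=
  ⨅ (p : Ideal R) (hp : p ∈ I.minimalPrimes),
    letI : p.IsPrime := hp.1.1
    (Ideal.map (algebraMap R (Localization.AtPrime p)) (I ^ n)).comap
      (algebraMap R (Localization.AtPrime p))

/-- The simplicial boundary operator on the space of chains (finitely supported
`K`-valued functions on finite subsets of `ι`), using the orientation coming
from the linear order of `ι`; a set of cardinality `d` is viewed as a
`(d-1)`-dimensional simplex, the empty set accounting for the augmentation. -/
def bdry (K : Type*) [Field K] {ι : Type*} [LinearOrder ι] :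
    (Finset ι →₀ K) →ₗ[K] (Finset ι →₀ K) :=
  Finsupp.lsum K fun σ => LinearMap.toSpanSingleton K _
    (∑ v ∈ σ, ((-1 : K) ^ (σ.filter fun w => w < v).card) • Finsupp.single (σ.erase v) (1 : K))

/-- The subspace of chains supported on the faces of `Δ` of cardinality `d`. -/
def cardFaces (K : Type*) [Field K] {ι : Type*} (Δ : FaceSet ι) (d : ℕ) :
    Submodule K (Finset ι →₀ K) :=
  Submodule.span K {f | ∃ σ ∈ Δ, σ.card = d ∧ f = Finsupp.single σ (1 : K)}

/-- `H̃ⱼ(Δ; K) ≠ 0`: there is a cycle of cardinality-degree `j + 1` which is not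
a boundary of a chain of `Δ`. -/
def HasNontrivialReducedHomology (K : Type*) [Field K] {ι : Type*} [LinearOrder ι]
    (Δ : FaceSet ι) (j : ℤ) : Prop :=
  ∃ d : ℕ, (d : ℤ) = j + 1 ∧
    ∃ z ∈ cardFaces K Δ d, bdry K z = 0 ∧ z ∉ ⇑(bdry K) '' ↑(cardFaces K Δ (d + 1))

/-- `G_α = {i : α_i < 0}`. -/
def negSupport {ι : Type*} [Fintype ι] (α : ι → ℤ) : Finset ι :=
  Finset.univ.filter fun i => α i < 0

/-- The degree complex `Δ_α(I) = {F ⊆ [r] \ G_α : x^α ∉ I·R_F}` of Takayama, where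
`x^α ∈ I·R_F` is expressed by saturation: `x^{α⁺}·(∏_{i ∈ F ∪ G_α} x_i)^m ∈ I` for some `m`. -/
def degreeComplex (K : Type*) [Field K] {ι : Type*} [Fintype ι] [LinearOrder ι]
    (I : Ideal (MvPolynomial ι K)) (α : ι → ℤ) : FaceSet ι :=
  {F | (∀ i ∈ F, 0 ≤ α i) ∧
    ¬∃ m : ℕ,
      monomial (Finsupp.equivFunOnFinite.symm fun i => (α i).toNat) (1 : K) *
        (∏ i ∈ F ∪ negSupport α, X i) ^ m ∈ I}

/-- Nonvanishing of the graded piece `H_𝔪^i(R/I)_α` of local cohomology of a monomial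
quotient, expressed via Takayama's formula
`dim_K H_𝔪^i(R/I)_α = dim_K H̃_{i-|G_α|-1}(Δ_α(I); K)`. -/
def lcNonzero (K : Type*) [Field K] {ι : Type*} [Fintype ι] [LinearOrder ι]
    (I : Ideal (MvPolynomial ι K)) (i : ℕ) (α : ι → ℤ) : Prop :=
  HasNontrivialReducedHomology K (degreeComplex K I α) ((i : ℤ) - (negSupport α).card - 1)

/-- The `a_i`-invariant `a_i(R/I) = max{t : H_𝔪^i(R/I)_t ≠ 0}` of a monomial quotient
(`H_𝔪^i(R/I)_t = ⊕_{|α| = t} H_𝔪^i(R/I)_α`). -/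
def aInv (K : Type*) [Field K] {ι : Type*} [Fintype ι] [LinearOrder ι]
    (I : Ideal (MvPolynomial ι K)) (i : ℕ) : ℤ :=
  sSup {z : ℤ | ∃ α : ι → ℤ, lcNonzero K I i α ∧ z = ∑ j, α j}

/-- The Castelnuovo–Mumford regularity `reg(R/I) = max_i (a_i(R/I) + i)` of a
monomial quotient. -/
def regQuot (K : Type*) [Field K] {ι : Type*} [Fintype ι] [LinearOrder ι]
    (I : Ideal (MvPolynomial ι K)) : ℤ :=
  sSup {z : ℤ | ∃ (i : ℕ) (α : ι → ℤ), lcNonzero K I i α ∧ z = (∑ j, α j) + i}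

/-- The Castelnuovo–Mumford regularity of a (monomial) ideal: `reg(I) = reg(R/I) + 1`. -/
def reg (K : Type*) [Field K] {ι : Type*} [Fintype ι] [LinearOrder ι]
    (I : Ideal (MvPolynomial ι K)) : ℤ :=
  regQuot K I + 1

/-- The depth `min{i : H_𝔪^i(R/I) ≠ 0}` of a monomial quotient. -/
def depthQuot (K : Type*) [Field K] {ι : Type*} [Fintype ι] [LinearOrder ι]
    (I : Ideal (MvPolynomial ι K)) : ℕ :=
  sInf {i : ℕ | ∃ α : ι → ℤ, lcNonzero K I i α}

/-- The projective dimension `pd(R/I) = r - depth(R/I)` (Auslander–Buchsbaum). -/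
def pdQuot (K : Type*) [Field K] {ι : Type*} [Fintype ι] [LinearOrder ι]
    (I : Ideal (MvPolynomial ι K)) : ℤ :=
  (Fintype.card ι : ℤ) - depthQuot K I

end
/-- The degrees of the minimal monomial generators of a monomial ideal `I`;
`d(I)` is the greatest element. -/
def minGenDegrees (K : Type*) [Field K] {ι : Type*} [Fintype ι]
    (I : Ideal (MvPolynomial ι K)) : Set ℕ :=
  {d | ∃ a : ι →₀ ℕ, monomial a (1 : K) ∈ I ∧
    (∀ b : ι →₀ ℕ, b ≤ a → b ≠ a → monomial b (1 : K) ∉ I) ∧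
    d = a.sum fun _ k => k}

theorem mem_cardFaces_iff {K : Type*} [Field K] {ι : Type*} {Δ : FaceSet ι} {d : ℕ}
    {z : Finset ι →₀ K} :
    z ∈ cardFaces K Δ d ↔ ∀ σ, z σ ≠ 0 → σ ∈ Δ ∧ σ.card = d := by
  have h : cardFaces K Δ d = Finsupp.supported K K {σ | σ ∈ Δ ∧ σ.card = d} := by
    rw [Finsupp.supported_eq_span_single, cardFaces]
    congr 1
    ext f
    constructor
    · rintro ⟨σ, hσ, hd, rfl⟩
      exact ⟨σ, ⟨hσ, hd⟩, rfl⟩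
    · rintro ⟨σ, ⟨hσ, hd⟩, rfl⟩
      exact ⟨σ, hσ, hd, rfl⟩
  rw [h, Finsupp.mem_supported']
  exact forall_congr' fun σ => by rw [← not_imp_not, not_not]; rfl

theorem cardFaces_mono (K : Type*) [Field K] {ι : Type*} {Δ Γ : FaceSet ι} (h : Δ ⊆ Γ) (d : ℕ) :
    cardFaces K Δ d ≤ cardFaces K Γ d := fun _ hz =>
  mem_cardFaces_iff.2 fun σ hσ => ⟨h (mem_cardFaces_iff.1 hz σ hσ).1,
    (mem_cardFaces_iff.1 hz σ hσ).2⟩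

theorem single_mem_cardFaces (K : Type*) [Field K] {ι : Type*} {Δ : FaceSet ι} {σ : Finset ι}
    (hσ : σ ∈ Δ) : Finsupp.single σ (1 : K) ∈ cardFaces K Δ σ.card :=
  Submodule.subset_span ⟨σ, hσ, rfl, rfl⟩

/-- Two linear maps on chains agree if they agree on simplices. -/
theorem chainMap_ext {K : Type*} [Field K] {ι : Type*} {M : Type*} [AddCommGroup M]
    [Module K M] {f g : (Finset ι →₀ K) →ₗ[K] M}
    (h : ∀ σ, f (Finsupp.single σ 1) = g (Finsupp.single σ 1)) : f = g := by
  ext σ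
  simpa using h σ

/-- The deletion of the vertex `v`. -/
def deletion {ι : Type*} (Δ : FaceSet ι) (v : ι) : FaceSet ι := {F | v ∉ F ∧ F ∈ Δ}

theorem IsSimplicialComplex.deletion {ι : Type*} {Δ : FaceSet ι} (hΔ : IsSimplicialComplex Δ)
    (v : ι) : IsSimplicialComplex (deletion Δ v) :=
  fun σ hσ τ h => ⟨fun hv => hσ.1 (h hv), hΔ σ hσ.2 τ h⟩

theorem apply_eq_zero_of_mem_deletion {K : Type*} [Field K] {ι : Type*} {Δ : FaceSet ι} {v : ι}
    {d : ℕ} {z : Finset ι →₀ K} (hz : z ∈ cardFaces K (deletion Δ v) d) {σ : Finset ι}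
    (hv : v ∈ σ) : z σ = 0 := by
  by_contra h
  exact (mem_cardFaces_iff.1 hz σ h).1.1 hv

section Chains

variable {K : Type*} [Field K] {ι : Type*} [LinearOrder ι]

theorem bdry_single (σ : Finset ι) :
    bdry K (Finsupp.single σ (1 : K)) =
      ∑ v ∈ σ, ((-1 : K) ^ (σ.filter fun w => w < v).card) •
        Finsupp.single (σ.erase v) (1 : K) := by
  simp [bdry]

variable (K) in
/-- The cone operator on chains, which adds the vertex `v` to every simplex not containing it. -/
noncomputable def coneMap (v : ι) : (Finset ι →₀ K) →ₗ[K] (Finset ι →₀ K) :=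
  Finsupp.lsum K fun σ => LinearMap.toSpanSingleton K _
    (if v ∈ σ then 0 else
      ((-1 : K) ^ (σ.filter fun w => w < v).card) • Finsupp.single (insert v σ) (1 : K))

theorem coneMap_single (v : ι) (σ : Finset ι) :
    coneMap K v (Finsupp.single σ (1 : K)) = if v ∈ σ then 0 else
      ((-1 : K) ^ (σ.filter fun w => w < v).card) • Finsupp.single (insert v σ) (1 : K) := by
  simp [coneMap]

theorem neg_one_pow_mul_self (k : ℕ) : (-1 : K) ^ k * (-1 : K) ^ k = 1 := by
  rw [← mul_pow]; simp

theorem coneMap_sign_cancel {σ : Finset ι} {v w : ι} (hv : v ∉ σ) (hw : w ∈ σ) :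
    (-1 : K) ^ (σ.filter fun u => u < v).card *
        (-1 : K) ^ ((insert v σ).filter fun u => u < w).card +
      (-1 : K) ^ (σ.filter fun u => u < w).card *
        (-1 : K) ^ ((σ.erase w).filter fun u => u < v).card = 0 := by
  have hne : w ≠ v := by rintro rfl; exact hv hw
  rcases lt_or_gt_of_ne hne with h | h
  · have h1 : (insert v σ).filter (fun u => u < w) = σ.filter fun u => u < w := by
      rw [Finset.filter_insert, if_neg h.not_gt]
    have h2 : (σ.filter fun u => u < v).card = ((σ.erase w).filter fun u => u < v).card + 1 := by
      rw [Finset.filter_erase, Finset.card_erase_add_one]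
      simp [hw, h]
    rw [h1, h2, pow_succ]; ring
  · have h1 : ((insert v σ).filter fun u => u < w).card = (σ.filter fun u => u < w).card + 1 := by
      rw [Finset.filter_insert, if_pos h, Finset.card_insert_of_notMem (by simp [hv])]
    have h2 : (σ.erase w).filter (fun u => u < v) = σ.filter fun u => u < v := by
      rw [Finset.filter_erase, Finset.erase_eq_of_notMem (by simp [h.not_gt])]
    rw [h1, h2, pow_succ]; ring

/-- The cone operator is a contracting homotopy of the full simplex. -/
theorem bdry_coneMap_add (v : ι) (z : Finset ι →₀ K) :
    bdry K (coneMap K v z) + coneMap K v (bdry K z) = z := by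
  suffices h : bdry K ∘ₗ coneMap K v + coneMap K v ∘ₗ bdry K = LinearMap.id from
    LinearMap.congr_fun h z
  refine chainMap_ext fun σ => ?_
  simp only [LinearMap.add_apply, LinearMap.comp_apply, LinearMap.id_apply, bdry_single, map_sum,
    map_smul, coneMap_single]
  by_cases hv : v ∈ σ
  · rw [if_pos hv, map_zero, zero_add, Finset.sum_eq_single_of_mem v hv]
    · have h : (σ.erase v).filter (fun u => u < v) = σ.filter fun u => u < v := by
        rw [Finset.filter_erase, Finset.erase_eq_of_notMem (by simp)]
      rw [if_neg (by simp), h, smul_smul, neg_one_pow_mul_self, one_smul, Finset.insert_erase hv]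
    · intro w _ hw
      rw [if_pos (by simp [hv, hw.symm]), smul_zero]
  · have h0 : (insert v σ).filter (fun u => u < v) = σ.filter fun u => u < v := by
      rw [Finset.filter_insert, if_neg (lt_irrefl v)]
    rw [if_neg hv, map_smul, bdry_single, Finset.sum_insert hv, smul_add, smul_smul, h0,
      neg_one_pow_mul_self, one_smul, Finset.erase_insert hv, add_assoc, Finset.smul_sum,
      ← Finset.sum_add_distrib, Finset.sum_eq_zero, add_zero]
    intro w hw
    have hne : v ≠ w := by rintro rfl; exact hv hw
    rw [if_neg (by simp [hv]), smul_smul, smul_smul, Finset.erase_insert_of_ne hne, ← add_smul,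
      coneMap_sign_cancel hv hw, zero_smul]

theorem bdry_bdry (z : Finset ι →₀ K) : bdry K (bdry K z) = 0 := by
  suffices h : bdry K ∘ₗ bdry K = (0 : (Finset ι →₀ K) →ₗ[K] _) from LinearMap.congr_fun h z
  refine chainMap_ext fun σ => ?_
  simp only [LinearMap.comp_apply, LinearMap.zero_apply]
  induction σ using Finset.induction_on with
  | empty => simp [bdry_single]
  | insert v σ hv ih =>
    have hs := coneMap_single (K := K) v σ
    rw [if_neg hv] at hs
    have h1 : Finsupp.single (insert v σ) (1 : K) =
        (-1 : K) ^ (σ.filter fun w => w < v).card • coneMap K v (Finsupp.single σ 1) := by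
      rw [hs, smul_smul, neg_one_pow_mul_self, one_smul]
    have h2 := bdry_coneMap_add (K := K) v (Finsupp.single σ 1)
    have h3 := bdry_coneMap_add (K := K) v (bdry K (Finsupp.single σ 1))
    rw [ih, map_zero, add_zero] at h3
    rw [h1, map_smul, map_smul, eq_sub_of_add_eq h2, map_sub, h3, sub_self, smul_zero]

theorem coneMap_mem_cardFaces {Δ : FaceSet ι} {v : ι} {d : ℕ}
    (hcone : ∀ F ∈ Δ, insert v F ∈ Δ) {z : Finset ι →₀ K} (hz : z ∈ cardFaces K Δ d) :
    coneMap K v z ∈ cardFaces K Δ (d + 1) := by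
  induction hz using Submodule.span_induction with
  | mem x hx =>
    obtain ⟨σ, hσ, rfl, rfl⟩ := hx
    rw [coneMap_single]
    split_ifs with h
    · exact zero_mem _
    · rw [← Finset.card_insert_of_notMem h]
      exact Submodule.smul_mem _ _ (single_mem_cardFaces K (hcone σ hσ))
  | zero => simp
  | add x y _ _ hx hy => rw [map_add]; exact add_mem hx hy
  | smul a x _ hx => rw [map_smul]; exact Submodule.smul_mem _ _ hx

/-- A cone has no reduced homology. -/
theorem not_hasNontrivialReducedHomology_of_cone {Δ : FaceSet ι} (v : ι)
    (hcone : ∀ F ∈ Δ, insert v F ∈ Δ) (j : ℤ) : ¬HasNontrivialReducedHomology K Δ j := by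
  rintro ⟨d, -, z, hz, hz0, hzb⟩
  refine hzb ⟨coneMap K v z, coneMap_mem_cardFaces hcone hz, ?_⟩
  simpa [hz0] using bdry_coneMap_add v z

theorem bdry_mem_cardFaces {Δ : FaceSet ι} (hΔ : IsSimplicialComplex Δ) {d : ℕ}
    {z : Finset ι →₀ K} (hz : z ∈ cardFaces K Δ (d + 1)) : bdry K z ∈ cardFaces K Δ d := by
  induction hz using Submodule.span_induction with
  | mem x hx =>
    obtain ⟨σ, hσ, hd, rfl⟩ := hx
    rw [bdry_single]
    refine Submodule.sum_mem _ fun v hv => Submodule.smul_mem _ _ ?_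
    have hc : (σ.erase v).card = d := by rw [Finset.card_erase_of_mem hv, hd]; rfl
    rw [← hc]
    exact single_mem_cardFaces K (hΔ σ hσ _ (Finset.erase_subset _ _))
  | zero => simp
  | add x y _ _ hx hy => rw [map_add]; exact add_mem hx hy
  | smul a x _ hx => rw [map_smul]; exact Submodule.smul_mem _ _ hx

/-- The link of the vertex `v`. -/
def vertexLink (Δ : FaceSet ι) (v : ι) : FaceSet ι := {F | v ∉ F ∧ insert v F ∈ Δ}

theorem IsSimplicialComplex.vertexLink {Δ : FaceSet ι} (hΔ : IsSimplicialComplex Δ) (v : ι) :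
    IsSimplicialComplex (vertexLink Δ v) :=
  fun _ hσ _ h => ⟨fun hv => hσ.1 (h hv), hΔ _ hσ.2 _ (Finset.insert_subset_insert v h)⟩

theorem IsSimplicialComplex.vertexLink_subset {Δ : FaceSet ι} (hΔ : IsSimplicialComplex Δ)
    (v : ι) : _root_.vertexLink Δ v ⊆ _root_.deletion Δ v :=
  fun _ hσ => ⟨hσ.1, hΔ _ hσ.2 _ (Finset.subset_insert _ _)⟩

theorem exists_deletion_add_coneMap {Δ : FaceSet ι} (v : ι) {d : ℕ} {w : Finset ι →₀ K}
    (hw : w ∈ cardFaces K Δ (d + 1)) :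
    ∃ w₀ ∈ cardFaces K (deletion Δ v) (d + 1), ∃ u ∈ cardFaces K (vertexLink Δ v) d,
      w = w₀ + coneMap K v u := by
  induction hw using Submodule.span_induction with
  | mem x hx =>
    obtain ⟨σ, hσ, hd, rfl⟩ := hx
    by_cases hv : v ∈ σ
    · have hc : (σ.erase v).card = d := by rw [Finset.card_erase_of_mem hv, hd]; rfl
      refine ⟨0, zero_mem _, (-1 : K) ^ ((σ.erase v).filter fun w => w < v).card •
        Finsupp.single (σ.erase v) (1 : K), Submodule.smul_mem _ _ ?_, ?_⟩
      · rw [← hc]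
        exact single_mem_cardFaces K ⟨by simp, by rwa [Finset.insert_erase hv]⟩
      · rw [map_smul, coneMap_single, if_neg (by simp), smul_smul, neg_one_pow_mul_self,
          Finset.insert_erase hv, one_smul, zero_add]
    · refine ⟨Finsupp.single σ 1, ?_, 0, zero_mem _, by simp⟩
      rw [← hd]
      exact single_mem_cardFaces K ⟨hv, hσ⟩
  | zero => exact ⟨0, zero_mem _, 0, zero_mem _, by simp⟩
  | add x y _ _ hx hy =>
    obtain ⟨x₀, hx₀, x₁, hx₁, rfl⟩ := hx
    obtain ⟨y₀, hy₀, y₁, hy₁, rfl⟩ := hy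
    exact ⟨_, add_mem hx₀ hy₀, _, add_mem hx₁ hy₁, by rw [map_add]; abel⟩
  | smul a x _ hx =>
    obtain ⟨x₀, hx₀, x₁, hx₁, rfl⟩ := hx
    exact ⟨_, Submodule.smul_mem _ a hx₀, _, Submodule.smul_mem _ a hx₁, by
      rw [map_smul, smul_add]⟩

theorem coneMap_apply_of_notMem {v : ι} (y : Finset ι →₀ K) {σ : Finset ι} (hv : v ∉ σ) :
    coneMap K v y σ = 0 := by
  suffices h : Finsupp.lapply σ ∘ₗ coneMap K v = (0 : (Finset ι →₀ K) →ₗ[K] K) from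
    LinearMap.congr_fun h y
  refine chainMap_ext fun τ => ?_
  simp only [LinearMap.comp_apply, LinearMap.zero_apply, Finsupp.lapply_apply, coneMap_single]
  split_ifs
  · simp
  · have : insert v τ ≠ σ := by rintro rfl; simp at hv
    simp [Finsupp.single_eq_of_ne this.symm]

theorem coneMap_eq_zero_of_mem_deletion {Δ : FaceSet ι} {v : ι} {d : ℕ} {y : Finset ι →₀ K}
    (hy : coneMap K v y ∈ cardFaces K (deletion Δ v) d) : coneMap K v y = 0 := by
  ext σ
  by_cases hv : v ∈ σ
  · exact apply_eq_zero_of_mem_deletion hy hv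
  · exact coneMap_apply_of_notMem y hv

/-- The part of the Mayer–Vietoris sequence of a vertex deletion used below: homology of the
deletion survives in the whole complex or comes from the link. -/
theorem hasNontrivialReducedHomology_of_deletion {Δ : FaceSet ι} (hΔ : IsSimplicialComplex Δ)
    (v : ι) {j : ℤ} (h : HasNontrivialReducedHomology K (deletion Δ v) j) :
    HasNontrivialReducedHomology K (vertexLink Δ v) j ∨ HasNontrivialReducedHomology K Δ j := by
  obtain ⟨d, hd, z, hz, hz0, hzb⟩ := h
  by_contra! hcon
  obtain ⟨hL, hD⟩ := hcon
  obtain ⟨w, hw, hwz⟩ : z ∈ ⇑(bdry K) '' ↑(cardFaces K Δ (d + 1)) := by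
    by_contra hn
    exact hD ⟨d, hd, z, cardFaces_mono K (fun _ h => h.2) d hz, hz0, hn⟩
  obtain ⟨w₀, hw₀, u, hu, rfl⟩ := exists_deletion_add_coneMap v hw
  have hcu := bdry_coneMap_add v u
  have hu' := cardFaces_mono K (hΔ.vertexLink_subset v) d hu
  have hkey : coneMap K v (bdry K u) = bdry K w₀ + u - z := by
    rw [← hwz, map_add]
    nth_rewrite 2 [← hcu]
    abel
  have hc0 : coneMap K v (bdry K u) = 0 := by
    refine coneMap_eq_zero_of_mem_deletion (Δ := Δ) (d := d) ?_
    rw [hkey]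
    exact sub_mem (add_mem (bdry_mem_cardFaces (hΔ.deletion v) hw₀) hu') hz
  have hbu : bdry K u = 0 := by
    have hcb := bdry_coneMap_add v (bdry K u)
    rw [hc0, map_zero, zero_add] at hcb
    rcases d with - | d
    · have h0 : u ∈ Submodule.span K {Finsupp.single (∅ : Finset ι) (1 : K)} := by
        refine Submodule.span_mono ?_ hu
        rintro _ ⟨σ, -, hσ, rfl⟩
        rw [Finset.card_eq_zero.1 hσ]
        rfl
      obtain ⟨a, rfl⟩ := Submodule.mem_span_singleton.1 h0
      rw [map_smul, bdry_single]
      simp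
    · rw [← hcb]
      refine coneMap_eq_zero_of_mem_deletion (Δ := Δ) (d := d) ?_
      rw [hcb]
      exact bdry_mem_cardFaces (hΔ.deletion v) hu'
  obtain ⟨t, ht, htu⟩ : u ∈ ⇑(bdry K) '' ↑(cardFaces K (vertexLink Δ v) (d + 1)) := by
    by_contra hn
    exact hL ⟨d, hd, u, hu, hbu, hn⟩
  refine hzb ⟨w₀ + t, add_mem hw₀ (cardFaces_mono K (hΔ.vertexLink_subset v) _ ht), ?_⟩
  rw [map_add, htu]
  rw [hc0] at hkey
  exact sub_eq_zero.1 hkey.symm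

/-- Homology of an induced subcomplex is detected by the link of some set of removed vertices. -/
theorem exists_link_hasNontrivialReducedHomology (A : Finset ι) {j : ℤ} :
    ∀ {Γ : FaceSet ι}, IsSimplicialComplex Γ →
      HasNontrivialReducedHomology K {F | Disjoint F A ∧ F ∈ Γ} j →
      ∃ G ⊆ A, HasNontrivialReducedHomology K {F | Disjoint F G ∧ F ∪ G ∈ Γ} j := by
  induction A using Finset.induction_on with
  | empty =>
    intro Γ _ h
    exact ⟨∅, subset_rfl, by simpa using h⟩
  | insert v A hv ih =>
    intro Γ hΓ h
    have hΓA : IsSimplicialComplex {F | Disjoint F A ∧ F ∈ Γ} :=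
      fun σ hσ τ h => ⟨Finset.disjoint_of_subset_left h hσ.1, hΓ σ hσ.2 τ h⟩
    have hdel : {F | Disjoint F (insert v A) ∧ F ∈ Γ} =
        deletion {F | Disjoint F A ∧ F ∈ Γ} v := by
      ext F
      simp [deletion, Finset.disjoint_insert_right, and_assoc]
    have hlink : vertexLink {F | Disjoint F A ∧ F ∈ Γ} v =
        {F | Disjoint F A ∧ F ∈ vertexLink Γ v} := by
      ext F
      simp only [vertexLink, Set.mem_ofPred_eq, Finset.disjoint_insert_left]
      tauto
    rw [hdel] at h
    rcases hasNontrivialReducedHomology_of_deletion hΓA v h with h | h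
    · rw [hlink] at h
      obtain ⟨G, hG, hG'⟩ := ih (hΓ.vertexLink v) h
      refine ⟨insert v G, Finset.insert_subset_insert v hG, ?_⟩
      convert hG' using 1
      have hvG : v ∉ G := fun h => hv (hG h)
      ext F
      simp only [vertexLink, Set.mem_ofPred_eq, Finset.disjoint_insert_right, Finset.mem_union,
        Finset.union_insert, hvG, or_false]
      tauto
    · obtain ⟨G, hG, hG'⟩ := ih hΓ h
      exact ⟨G, hG.trans (Finset.subset_insert _ _), hG'⟩

/-- The boundary of a simplex has nontrivial top homology. -/
theorem hasNontrivialReducedHomology_ssubset {V : Finset ι} (hV : V.Nonempty) :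
    HasNontrivialReducedHomology K {F | F ⊂ V} ((V.card : ℤ) - 2) := by
  obtain ⟨v, hv⟩ := hV
  have hpos : 0 < V.card := Finset.card_pos.2 ⟨v, hv⟩
  refine ⟨V.card - 1, by omega, bdry K (Finsupp.single V 1), ?_, bdry_bdry _, ?_⟩
  · rw [bdry_single]
    refine Submodule.sum_mem _ fun w hw => Submodule.smul_mem _ _ ?_
    rw [← Finset.card_erase_of_mem hw]
    exact single_mem_cardFaces K (Finset.erase_ssubset hw)
  · rintro ⟨y, hy, hyz⟩
    have hy0 : y = 0 := by
      ext σ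
      by_contra hne
      obtain ⟨h1, h2⟩ := mem_cardFaces_iff.1 hy σ hne
      have := Finset.card_lt_card h1
      omega
    have hz := DFunLike.congr_fun hyz (V.erase v)
    rw [hy0, map_zero, bdry_single, Finsupp.finsetSum_apply, Finset.sum_eq_single_of_mem v hv] at hz
    · simp only [Finsupp.coe_zero, Pi.zero_apply, Finsupp.smul_apply, Finsupp.single_eq_same,
        smul_eq_mul, mul_one] at hz
      exact pow_ne_zero _ (neg_ne_zero.2 one_ne_zero) hz.symm
    · intro w hw hne
      have : V.erase w ≠ V.erase v := fun h =>
        hne (Finset.erase_injOn V hw hv h)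
      simp [Finsupp.single_eq_of_ne this.symm]

end Chains

section MonomialIdeals

variable {K : Type*} [Field K] {ι : Type*}

/-- A square-free monomial, written as a product of variables. -/
theorem prod_X_eq_monomial (τ : Finset ι) :
    (∏ i ∈ τ, X i : MvPolynomial ι K) = monomial (∑ i ∈ τ, Finsupp.single i 1) 1 := by
  rw [monomial_sum_one]
  rfl

theorem sum_single_one_apply [DecidableEq ι] (τ : Finset ι) (j : ι) :
    (∑ i ∈ τ, Finsupp.single i 1 : ι →₀ ℕ) j = if j ∈ τ then 1 else 0 := by
  simp [Finsupp.finsetSum_apply, Finsupp.single_apply]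

theorem sum_single_one_le_iff {τ : Finset ι} {a : ι →₀ ℕ} :
    (∑ i ∈ τ, Finsupp.single i 1) ≤ a ↔ τ ⊆ a.support := by
  classical
  simp only [Finsupp.le_def, sum_single_one_apply, Finset.subset_iff, Finsupp.mem_support_iff]
  refine forall_congr' fun j => ?_
  by_cases hj : j ∈ τ <;> simp [hj, Nat.one_le_iff_ne_zero]

theorem monomial_mem_srIdeal {Δ : FaceSet ι} {a : ι →₀ ℕ} :
    monomial a (1 : K) ∈ srIdeal K Δ ↔ ∃ τ, τ ∉ Δ ∧ τ ⊆ a.support := by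
  classical
  have h : {p : MvPolynomial ι K | ∃ τ : Finset ι, τ ∉ Δ ∧ p = ∏ i ∈ τ, X i} =
      (fun s => monomial s (1 : K)) '' ((fun τ => ∑ i ∈ τ, Finsupp.single i 1) '' {τ | τ ∉ Δ}) := by
    ext p
    simp [prod_X_eq_monomial, eq_comm]
  rw [srIdeal, h, mem_ideal_span_monomial_image]
  simp [support_monomial, sum_single_one_le_iff]

/-- Minimal monomial generators of a Stanley–Reisner ideal correspond to minimal non-faces. -/
theorem exists_minimal_nonface {Δ : FaceSet ι} [Fintype ι] [DecidableEq ι] {d : ℕ}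
    (hd : d ∈ minGenDegrees K (srIdeal K Δ)) :
    ∃ V, V ∉ Δ ∧ (∀ i ∈ V, V.erase i ∈ Δ) ∧ V.card = d := by
  obtain ⟨a, ha, hmin, rfl⟩ := hd
  obtain ⟨τ, hτ, hτa⟩ := monomial_mem_srIdeal.1 ha
  have hind (σ : Finset ι) (hσ : σ ∉ Δ) :
      monomial (∑ i ∈ σ, Finsupp.single i 1) (1 : K) ∈ srIdeal K Δ :=
    monomial_mem_srIdeal.2 ⟨σ, hσ, sum_single_one_le_iff.1 le_rfl⟩
  have haτ : ∑ i ∈ τ, Finsupp.single i 1 = a := by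
    by_contra hne
    exact hmin _ (sum_single_one_le_iff.2 hτa) hne (hind τ hτ)
  subst haτ
  refine ⟨τ, hτ, fun i hi => ?_, ?_⟩
  · by_contra hn
    refine hmin _ (sum_single_one_le_iff.2 ((Finset.erase_subset i τ).trans hτa)) (fun h => ?_)
      (hind _ hn)
    have := DFunLike.congr_fun h i
    simp [sum_single_one_apply, hi] at this
  · rw [Finsupp.sum_fintype _ _ fun _ => rfl]
    simp [sum_single_one_apply]

theorem exists_facet_superset [Finite ι] {Δ : FaceSet ι} {σ : Finset ι} (hσ : σ ∈ Δ) :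
    ∃ F ∈ facets Δ, σ ⊆ F := by
  obtain ⟨F, hF, hmax⟩ := (Set.toFinite Δ).exists_le_maximal hσ
  exact ⟨F, ⟨hmax.1, fun τ hτ h => le_antisymm h (hmax.2 hτ h)⟩, hF⟩

variable (K) in
open Classical in
/-- The substitution which sets the variables outside `F` to zero. -/
noncomputable def restrictVars (F : Finset ι) : MvPolynomial ι K →ₐ[K] MvPolynomial ι K :=
  aeval fun k => if k ∈ F then X k else 0

variable (K) in
/-- The prime ideal generated by the variables outside `F`. -/
noncomputable def facePrime (F : Finset ι) : Ideal (MvPolynomial ι K) :=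
  RingHom.ker (restrictVars K F)

instance facePrime_isPrime (F : Finset ι) : (facePrime K F).IsPrime :=
  RingHom.ker_isPrime _

theorem X_mem_facePrime {F : Finset ι} {k : ι} : X k ∈ facePrime K F ↔ k ∉ F := by
  by_cases h : k ∈ F <;> simp [facePrime, RingHom.mem_ker, restrictVars, h]

theorem facePrime_le {F : Finset ι} {P : Ideal (MvPolynomial ι K)}
    (h : ∀ k ∉ F, X k ∈ P) : facePrime K F ≤ P := by
  intro f hf
  have hc : (Ideal.Quotient.mkₐ K P).comp (restrictVars K F) = Ideal.Quotient.mkₐ K P := by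
    refine algHom_ext fun k => ?_
    by_cases hk : k ∈ F
    · simp [restrictVars, hk]
    · simp [restrictVars, hk, (Ideal.Quotient.eq_zero_iff_mem.2 (h k hk))]
  have hfc := DFunLike.congr_fun hc f
  rw [AlgHom.comp_apply, (RingHom.mem_ker (f := restrictVars K F)).1 hf, map_zero] at hfc
  exact Ideal.Quotient.eq_zero_iff_mem.1 hfc.symm

theorem srIdeal_le_facePrime {Δ : FaceSet ι} (hΔ : IsSimplicialComplex Δ) {F : Finset ι}
    (hF : F ∈ Δ) : srIdeal K Δ ≤ facePrime K F := by
  refine Ideal.span_le.2 ?_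
  rintro _ ⟨τ, hτ, rfl⟩
  obtain ⟨k, hk, hkF⟩ := Finset.not_subset.1 fun h => hτ (hΔ F hF τ h)
  exact Ideal.mem_of_dvd _ (Finset.dvd_prod_of_mem _ hk) (X_mem_facePrime.2 hkF)

theorem facePrime_mem_minimalPrimes {Δ : FaceSet ι} (hΔ : IsSimplicialComplex Δ) {F : Finset ι}
    (hF : F ∈ facets Δ) : facePrime K F ∈ (srIdeal K Δ).minimalPrimes := by
  classical
  refine ⟨⟨inferInstance, srIdeal_le_facePrime hΔ hF.1⟩, fun P hP hPF => facePrime_le ?_⟩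
  have := hP.1
  intro k hk
  have hn : insert k F ∉ Δ := fun h => hk (by
    rw [hF.2 _ h (Finset.subset_insert _ _)]; exact Finset.mem_insert_self _ _)
  have hmem : ∏ i ∈ insert k F, X i ∈ P := hP.2 (Ideal.subset_span ⟨_, hn, rfl⟩)
  rw [Finset.prod_insert hk] at hmem
  refine (hP.1.mem_or_mem hmem).resolve_right fun h => ?_
  obtain ⟨i, hi, hiP⟩ := hP.1.prod_mem_iff.1 h
  exact X_mem_facePrime.1 (hPF hiP) hi

/-- A variable in `facePrime K F` has order exactly one there. -/
theorem mem_facePrime_of_mul_X_pow_mem {F : Finset ι} {i : ι} {m : ℕ}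
    {s : MvPolynomial ι K} (h : s * X i ^ m ∈ facePrime K F ^ (m + 1)) (hi : i ∉ F) :
    s ∈ facePrime K F := by
  classical
  let φ : MvPolynomial ι K →ₐ[K] Polynomial (MvPolynomial ι K) :=
    aeval fun k => if k ∈ F then Polynomial.C (X k) else Polynomial.C (X k) * Polynomial.X
  have hφ (f : MvPolynomial ι K) : (φ f).eval 0 = restrictVars K F f := by
    have hc : ((Polynomial.aeval (0 : MvPolynomial ι K)).restrictScalars K).comp φ =
        restrictVars K F := by
      refine algHom_ext fun k => ?_
      by_cases hk : k ∈ F <;> simp [φ, restrictVars, hk]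
    rw [← hc]
    simp
  have hle : (facePrime K F).map φ ≤ Ideal.span {Polynomial.X} := by
    rw [Ideal.map_le_iff_le_comap]
    intro f hf
    rw [Ideal.mem_comap, Ideal.mem_span_singleton, Polynomial.X_dvd_iff,
      Polynomial.coeff_zero_eq_eval_zero, hφ]
    exact hf
  have hmem : φ (s * X i ^ m) ∈ Ideal.span {(Polynomial.X : Polynomial (MvPolynomial ι K))} ^
      (m + 1) := by
    refine Ideal.pow_right_mono hle _ ?_
    rw [← Ideal.map_pow]
    exact Ideal.mem_map_of_mem _ h
  have hXi : φ (X i) = Polynomial.C (X i) * Polynomial.X := by simp [φ, hi]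
  rw [Ideal.span_singleton_pow, Ideal.mem_span_singleton, map_mul, map_pow, hXi, mul_pow,
    ← mul_assoc, pow_succ', mul_dvd_mul_iff_right (pow_ne_zero _ Polynomial.X_ne_zero),
    Polynomial.X_dvd_iff, Polynomial.coeff_zero_eq_eval_zero, Polynomial.eval_mul, hφ] at hmem
  have hne : ((Polynomial.C (X i : MvPolynomial ι K)) ^ m).eval 0 ≠ 0 := by
    simp
  exact (mul_eq_zero.1 hmem).resolve_right hne

theorem exists_mul_mem_pow_of_mem_symbolicPower {R : Type*} [CommRing R] {I p : Ideal R}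
    (hp : p ∈ I.minimalPrimes) {n : ℕ} {y : R} (hy : y ∈ symbolicPower I n) :
    ∃ s ∉ p, s * y ∈ I ^ n := by
  have := hp.1.1
  rw [symbolicPower, Submodule.mem_iInf] at hy
  have h := (Submodule.mem_iInf _).1 (hy p) hp
  obtain ⟨s, hs, hsy⟩ := (IsLocalization.algebraMap_mem_map_algebraMap_iff p.primeCompl
    (Localization.AtPrime p) (I ^ n) y).1 h
  exact ⟨s, hs, hsy⟩

theorem pow_le_symbolicPower {R : Type*} [CommRing R] (I : Ideal R) (n : ℕ) :
    I ^ n ≤ symbolicPower I n :=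
  le_iInf fun _ => le_iInf fun _ => Ideal.le_comap_map

theorem notMem_symbolicPower_of_minimal_nonface [Finite ι] [DecidableEq ι] {Δ : FaceSet ι}
    (hΔ : IsSimplicialComplex Δ) {V : Finset ι} (hV : V ∉ Δ) {i : ι} (hi : i ∈ V)
    (hiΔ : V.erase i ∈ Δ) (n m : ℕ) :
    (∏ k ∈ V, X k) ^ n * (∏ k ∈ V.erase i, X k) ^ m ∉ symbolicPower (srIdeal K Δ) (n + 1) := by
  intro hmem
  obtain ⟨F, hF, hVF⟩ := exists_facet_superset hiΔ
  have hiF : i ∉ F := fun h => hV (hΔ F hF.1 V fun k hk => by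
    by_cases hki : k = i
    · rwa [hki]
    · exact hVF (Finset.mem_erase.2 ⟨hki, hk⟩))
  obtain ⟨s, hs, hsy⟩ := exists_mul_mem_pow_of_mem_symbolicPower
    (facePrime_mem_minimalPrimes hΔ hF) hmem
  have hQ := Ideal.pow_right_mono (srIdeal_le_facePrime (K := K) hΔ hF.1) (n + 1) hsy
  rw [← Finset.mul_prod_erase V _ hi] at hQ
  have hu : s * (∏ k ∈ V.erase i, X k) ^ (n + m) ∈ facePrime K F := by
    refine mem_facePrime_of_mul_X_pow_mem (m := n) ?_ hiF
    convert hQ using 1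
    ring
  have hprod := (facePrime_isPrime F).mem_of_pow_mem _
    (((facePrime_isPrime F).mem_or_mem hu).resolve_left hs)
  obtain ⟨k, hk, hkF⟩ := (facePrime_isPrime F).prod_mem_iff.1 hprod
  exact X_mem_facePrime.1 hkF (hVF hk)

end MonomialIdeals

section DegreeComplexes

variable {K : Type*} [Field K] {ι : Type*} [Fintype ι] [LinearOrder ι]

theorem isSimplicialComplex_degreeComplex (J : Ideal (MvPolynomial ι K)) (α : ι → ℤ) :
    IsSimplicialComplex (degreeComplex K J α) := by
  rintro σ ⟨hσ, hm⟩ τ h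
  refine ⟨fun i hi => hσ i (h hi), fun ⟨m, hmem⟩ => hm ⟨m, Ideal.mem_of_dvd _ ?_ hmem⟩⟩
  exact mul_dvd_mul_left _ (pow_dvd_pow_of_dvd
    (Finset.prod_dvd_prod_of_subset _ _ _ (Finset.union_subset_union_left h)) m)

/-- Lowering coordinates from `0` to `-1` replaces the degree complex by a link. -/
theorem degreeComplex_neg_one (J : Ideal (MvPolynomial ι K)) {α : ι → ℤ} (hα : ∀ i, 0 ≤ α i)
    {G : Finset ι} (hG : ∀ i ∈ G, α i = 0) :
    degreeComplex K J (fun i => if i ∈ G then -1 else α i) =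
      {F | Disjoint F G ∧ F ∪ G ∈ degreeComplex K J α} := by
  have hneg : negSupport (fun i => if i ∈ G then -1 else α i) = G := by
    ext i
    by_cases hi : i ∈ G <;> simp [negSupport, hi, hα i]
  have hneg' : negSupport α = ∅ := by
    ext i
    simp [negSupport, hα i]
  have hexp : (fun i => (if i ∈ G then (-1 : ℤ) else α i).toNat) = fun i => (α i).toNat := by
    funext i
    by_cases hi : i ∈ G <;> simp [hi, hG]
  have hdisj (F : Finset ι) : (∀ i ∈ F, 0 ≤ if i ∈ G then -1 else α i) ↔ Disjoint F G := by
    rw [Finset.disjoint_left]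
    refine forall₂_congr fun i _ => ?_
    by_cases hi : i ∈ G <;> simp [hi, hα i]
  ext F
  simp only [degreeComplex, Set.mem_ofPred_eq, hneg, hneg', hexp, hdisj, Finset.union_empty]
  simp [hα]

/-- In a Noetherian ring the saturation by an element is a colon ideal. -/
theorem exists_forall_mul_pow_mem {R : Type*} [CommRing R] [IsNoetherianRing R] (J : Ideal R)
    (x : R) : ∃ M : ℕ, ∀ y k, y * x ^ k ∈ J → y * x ^ M ∈ J := by
  let f : ℕ →o Submodule R R :=
    ⟨fun k => Submodule.comap (LinearMap.mulRight R (x ^ k)) J, fun a b hab y hy => by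
      simp only [Submodule.mem_comap, LinearMap.mulRight_apply] at hy ⊢
      exact Ideal.mem_of_dvd _ (mul_dvd_mul_left _ (pow_dvd_pow x hab)) hy⟩
  obtain ⟨M, hM⟩ := monotone_stabilizes_iff_noetherian.2 ‹IsNoetherianRing R› f
  refine ⟨M, fun y k hy => ?_⟩
  have h1 : y ∈ f (max M k) := f.mono (le_max_right M k) hy
  rw [← hM _ (le_max_left M k)] at h1
  exact h1

/-- For large exponents in one coordinate the degree complex is a cone. -/
theorem exists_degreeComplex_cone (J : Ideal (MvPolynomial ι K)) :
    ∃ M : ℕ, ∀ (α : ι → ℤ) (j : ι), (M : ℤ) ≤ α j →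
      ∀ F ∈ degreeComplex K J α, insert j F ∈ degreeComplex K J α := by
  choose M hM using fun j : ι => exists_forall_mul_pow_mem J (X j)
  refine ⟨Finset.univ.sup M, fun α j hj F hF => ⟨fun i hi => ?_, fun ⟨m, hm⟩ => hF.2 ⟨m, ?_⟩⟩⟩
  · rcases Finset.mem_insert.1 hi with rfl | hi
    · exact (Int.natCast_nonneg _).trans hj
    · exact hF.1 i hi
  set a : ι →₀ ℕ := Finsupp.equivFunOnFinite.symm fun i => (α i).toNat
  have hMa : Finsupp.single j (M j) ≤ a := by
    rw [Finsupp.single_le_iff]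
    have h1 : M j ≤ Finset.univ.sup M := Finset.le_sup (Finset.mem_univ j)
    have h2 : a j = (α j).toNat := rfl
    omega
  have ha : monomial a (1 : K) = monomial (a - Finsupp.single j (M j)) 1 * X j ^ M j := by
    rw [X_pow_eq_monomial, monomial_mul, tsub_add_cancel_of_le hMa, one_mul]
  have hdvd : (∏ i ∈ insert j F ∪ negSupport α, X i : MvPolynomial ι K) ∣
      (∏ i ∈ F ∪ negSupport α, X i) * X j := by
    rw [Finset.insert_union]
    by_cases hjF : j ∈ F ∪ negSupport α
    · rw [Finset.insert_eq_self.2 hjF]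
      exact dvd_mul_right _ _
    · rw [Finset.prod_insert hjF, mul_comm]
  have hmem : monomial (a - Finsupp.single j (M j)) 1 * (∏ i ∈ F ∪ negSupport α, X i) ^ m *
      X j ^ (M j + m) ∈ J := by
    refine Ideal.mem_of_dvd _ ?_ hm
    refine (mul_dvd_mul_left _ (pow_dvd_pow_of_dvd hdvd m)).trans (dvd_of_eq ?_)
    rw [ha]
    ring
  have h := hM j _ _ hmem
  rw [ha]
  convert h using 1
  ring

/-- The set whose supremum is `regQuot K J` is bounded above. -/
theorem bddAbove_regQuot (J : Ideal (MvPolynomial ι K)) :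
    BddAbove {z : ℤ | ∃ (i : ℕ) (α : ι → ℤ), lcNonzero K J i α ∧ z = (∑ j, α j) + i} := by
  obtain ⟨M, hM⟩ := exists_degreeComplex_cone J
  refine ⟨Fintype.card ι * M + 2 * Fintype.card ι, ?_⟩
  rintro _ ⟨i, α, hlc, rfl⟩
  have hα (j : ι) : α j ≤ M := by
    by_contra! hj
    exact not_hasNontrivialReducedHomology_of_cone j (hM α j hj.le) _ hlc
  have hsum : ∑ j, α j ≤ Fintype.card ι * M := by
    simpa using Finset.sum_le_card_nsmul Finset.univ α M fun j _ => hα j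
  obtain ⟨d, hd, z, hz, -, hzb⟩ := hlc
  have hz0 : z ≠ 0 := by
    rintro rfl
    exact hzb ⟨0, zero_mem _, map_zero _⟩
  obtain ⟨σ, hσ⟩ := DFunLike.ne_iff.1 hz0
  have hdcard : d ≤ Fintype.card ι :=
    (mem_cardFaces_iff.1 hz σ hσ).2 ▸ Finset.card_le_univ σ
  have hneg : (negSupport α).card ≤ Fintype.card ι := Finset.card_le_univ _
  omega

theorem le_regQuot_of_lcNonzero {J : Ideal (MvPolynomial ι K)} {i : ℕ} {α : ι → ℤ}
    (h : lcNonzero K J i α) : (∑ j, α j) + i ≤ regQuot K J :=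
  le_csSup (bddAbove_regQuot J) ⟨i, α, h, rfl⟩

theorem regQuot_top : regQuot K (⊤ : Ideal (MvPolynomial ι K)) = 0 := by
  have hlc (i : ℕ) (α : ι → ℤ) : ¬lcNonzero K (⊤ : Ideal (MvPolynomial ι K)) i α := by
    rintro ⟨d, -, z, hz, -, hzb⟩
    have hz0 : z = 0 := by
      ext σ
      by_contra hσ
      exact (mem_cardFaces_iff.1 hz σ hσ).1.2 ⟨0, Submodule.mem_top⟩
    exact hzb ⟨0, zero_mem _, by rw [map_zero, hz0]⟩
  simp [regQuot, hlc]

/-- If the degree complex of a nonnegative vector restricts to the boundary of a simplex on its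
support, the regularity is at least the corresponding degree. -/
theorem le_regQuot_of_restriction_eq_ssubset {J : Ideal (MvPolynomial ι K)} {V : Finset ι}
    (hV : V.Nonempty) {α : ι → ℤ} (hα : ∀ i, 0 ≤ α i) (hαV : ∀ i ∉ V, α i = 0)
    (hres : {F | Disjoint F Vᶜ ∧ F ∈ degreeComplex K J α} = {F | F ⊂ V}) :
    (∑ i, α i) + V.card - 1 ≤ regQuot K J := by
  have hpos : 0 < V.card := Finset.card_pos.2 hV
  have hH := hasNontrivialReducedHomology_ssubset (K := K) hV
  rw [← hres] at hH
  obtain ⟨G, hG, hGH⟩ :=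
    exists_link_hasNontrivialReducedHomology Vᶜ (isSimplicialComplex_degreeComplex J α) hH
  have hG0 : ∀ i ∈ G, α i = 0 := fun i hi => hαV i (Finset.mem_compl.1 (hG hi))
  rw [← degreeComplex_neg_one J hα hG0] at hGH
  have hneg : negSupport (fun i => if i ∈ G then -1 else α i) = G := by
    ext i
    by_cases hi : i ∈ G <;> simp [negSupport, hi, hα i]
  have hsum : ∑ i, (if i ∈ G then -1 else α i) = (∑ i, α i) - G.card := by
    have h (i : ι) : (if i ∈ G then -1 else α i) = α i - if i ∈ G then 1 else 0 := by
      by_cases hi : i ∈ G <;> simp [hi, hG0]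
    simp [h, Finset.sum_sub_distrib]
  have hlc : lcNonzero K J (V.card - 1 + G.card) fun i => if i ∈ G then -1 else α i := by
    rw [lcNonzero, hneg]
    convert hGH using 1
    omega
  have := le_regQuot_of_lcNonzero hlc
  rw [hsum] at this
  omega

end DegreeComplexes

theorem restriction_degreeComplex_symbolicPower {K : Type*} [Field K] {ι : Type*} [Fintype ι]
    [LinearOrder ι] {Δ : FaceSet ι} (hΔ : IsSimplicialComplex Δ) {V : Finset ι} (hV : V ∉ Δ)
    (hVΔ : ∀ i ∈ V, V.erase i ∈ Δ) (n : ℕ) :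
    {F | Disjoint F Vᶜ ∧ F ∈ degreeComplex K (symbolicPower (srIdeal K Δ) (n + 1))
      fun i => if i ∈ V then (n : ℤ) else 0} = {F | F ⊂ V} := by
  set α : ι → ℤ := fun i => if i ∈ V then (n : ℤ) else 0 with hα
  have hnn : ∀ i, 0 ≤ α i := fun i => by
    by_cases hi : i ∈ V <;> simp [hα, hi]
  have hneg : negSupport α = ∅ := by
    ext i
    simp [negSupport, hnn i]
  have hmon : monomial (Finsupp.equivFunOnFinite.symm fun i => (α i).toNat) (1 : K) =
      (∏ i ∈ V, X i) ^ n := by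
    rw [prod_X_eq_monomial, monomial_pow, one_pow]
    refine congrArg (fun a => monomial a (1 : K)) (Finsupp.ext fun i => ?_)
    rw [Finsupp.smul_apply, sum_single_one_apply]
    by_cases hi : i ∈ V <;> simp [hα, hi]
  have hmem (F : Finset ι) : F ∈ degreeComplex K (symbolicPower (srIdeal K Δ) (n + 1)) α ↔
      ¬∃ m : ℕ, (∏ i ∈ V, X i) ^ n * (∏ i ∈ F, X i) ^ m ∈
        symbolicPower (srIdeal K Δ) (n + 1) := by
    simp [degreeComplex, hnn, hneg, hmon]
  have hVJ : V ∉ degreeComplex K (symbolicPower (srIdeal K Δ) (n + 1)) α := by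
    rw [hmem, not_not]
    have hVI : ∏ i ∈ V, X i ∈ srIdeal K Δ := Ideal.subset_span ⟨V, hV, rfl⟩
    refine ⟨1, pow_le_symbolicPower _ _ ?_⟩
    rw [pow_one, ← pow_succ]
    exact Ideal.pow_mem_pow hVI _
  ext F
  simp only [Set.mem_ofPred_eq, disjoint_compl_right_iff]
  constructor
  · rintro ⟨hFV, hF⟩
    refine Finset.ssubset_iff_subset_ne.2 ⟨hFV, ?_⟩
    rintro rfl
    exact hVJ hF
  · intro hFV
    refine ⟨hFV.subset, ?_⟩
    obtain ⟨i, hi, hiF⟩ := Finset.exists_of_ssubset hFV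
    refine isSimplicialComplex_degreeComplex _ _ (V.erase i) ?_ F
      (Finset.subset_erase.2 ⟨hFV.subset, hiF⟩)
    rw [hmem]
    rintro ⟨m, hm⟩
    exact notMem_symbolicPower_of_minimal_nonface hΔ hV hi (hVΔ i hi) n m hm

/-- For a square-free monomial ideal `I` of `R = K[x_1, …, x_r]`:
`reg(I^{(n)}) ≥ d(I)·n` for all `n ≥ 1`, where `d(I)` is the maximal degree of a
minimal monomial generator of `I`. -/
theorem statement14 {K : Type*} [Field K] {r : ℕ}
    (I : Ideal (MvPolynomial (Fin r) K))
    (hI : ∃ Δ : FaceSet (Fin r), IsSimplicialComplex Δ ∧ I = srIdeal K Δ)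
    (dI : ℕ) (hdI : IsGreatest (minGenDegrees K I) dI)
    (n : ℕ) (hn : 1 ≤ n) :
    (dI : ℤ) * n ≤ reg K (symbolicPower I n) := by
  obtain ⟨Δ, hΔ, rfl⟩ := hI
  obtain ⟨V, hV, hVΔ, rfl⟩ := exists_minimal_nonface hdI.1
  obtain ⟨n, rfl⟩ := Nat.exists_eq_add_of_le' hn
  rw [reg]
  rcases V.eq_empty_or_nonempty with rfl | hVne
  · have htop : srIdeal K Δ = ⊤ :=
      (Ideal.eq_top_iff_one _).2 (Ideal.subset_span ⟨∅, hV, by simp⟩)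
    have hsym : symbolicPower (srIdeal K Δ) (n + 1) = ⊤ := by
      refine top_le_iff.1 ?_
      conv_lhs => rw [← Ideal.top_pow _ (n + 1), ← htop]
      exact pow_le_symbolicPower _ _
    rw [hsym, regQuot_top]
    simp
  · have h := le_regQuot_of_restriction_eq_ssubset hVne
      (fun i => by by_cases hi : i ∈ V <;> simp [hi]) (fun i hi => by simp [hi])
      (restriction_degreeComplex_symbolicPower (K := K) hΔ hV hVΔ n)
    have hsum : ∑ i, (if i ∈ V then (n : ℤ) else 0) = V.card * n := by simp
    rw [hsum] at h
    push_cast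
    linarith
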